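/- Let G be an infinite countable discrete group, S ⊂ G, and ω an S-admissible weight on G. There exists an S-dense vector in ℓ^p(G,ω) if and only if for every increasing sequence (F_n)_{n≥1} of finite subsets of G there exists a sequence (s_n)_{n≥1} ⊂ S such that the sets s_n⁻¹F_n are pairwise disjoint and, with s_0 = e, F_0 = ∅, the sum over all pairs n ≠ k of Σ_{t ∈ s_n s_k⁻¹ F_k} ω(t)^p is finite. -/

import Mathlib

open ENNReal

noncomputable section

variable {G : Type*}

/-- Weighted `ℓ^p` norm on a discrete group (counting measure). -/
def wNormD (p : ℝ) (ω : G → ℝ) (f : G → ℂ) : ℝ≥0∞ :=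
  (∑' t, (‖f t‖₊ * ENNReal.ofReal (ω t)) ^ p) ^ (1 / p)

/-- Left translation operator `(T_s f)(t) = f(s⁻¹ t)`. -/
def transl [Group G] (s : G) (f : G → ℂ) : G → ℂ := fun t => f (s⁻¹ * t)

/-- The translation `T_s` is a bounded operator on `ℓ^p(G,ω)`. -/
def BoundedTranslD [Group G] (p : ℝ) (ω : G → ℝ) (s : G) : Prop :=
  ∃ C : ℝ≥0∞, C < ⊤ ∧ ∀ f : G → ℂ, wNormD p ω (transl s f) ≤ C * wNormD p ω f

/-- `x` is an `S`-dense vector in `ℓ^p(G,ω)`: its `S`-orbit is dense. -/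
def SDenseVecD [Group G] (p : ℝ) (ω : G → ℝ) (S : Set G) (x : G → ℂ) : Prop :=
  wNormD p ω x < ⊤ ∧
    ∀ g : G → ℂ, wNormD p ω g < ⊤ → ∀ ε : ℝ, 0 < ε →
      ∃ s ∈ S, wNormD p ω (fun t => transl s x t - g t) < ENNReal.ofReal ε

open Filter Topology

/-- The `p`-th power of the weighted `ℓ^p` norm. -/
def wPow (p : ℝ) (ω : G → ℝ) (f : G → ℂ) : ℝ≥0∞ :=
  ∑' t, (‖f t‖₊ * ENNReal.ofReal (ω t)) ^ p

theorem wNormD_lt_iff {p : ℝ} (hp : 0 < p) (ω : G → ℝ) (f : G → ℂ) (c : ℝ≥0∞) :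
    wNormD p ω f < c ↔ wPow p ω f < c ^ p := by
  have h : wNormD p ω f ^ p = wPow p ω f := by
    rw [wNormD, ← ENNReal.rpow_mul, one_div, inv_mul_cancel₀ hp.ne', ENNReal.rpow_one, wPow]
  rw [← h, ENNReal.rpow_lt_rpow_iff hp]

theorem wNormD_lt_top_iff {p : ℝ} (hp : 0 < p) (ω : G → ℝ) (f : G → ℂ) :
    wNormD p ω f < ⊤ ↔ wPow p ω f < ⊤ := by
  rw [wNormD_lt_iff hp, ENNReal.top_rpow_of_pos hp]

theorem wPow_add_le {p : ℝ} (hp : 1 ≤ p) (ω : G → ℝ) (f g : G → ℂ) :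
    wPow p ω (fun t => f t + g t) ≤ 2 ^ (p - 1) * (wPow p ω f + wPow p ω g) := by
  simp only [wPow]
  rw [← ENNReal.tsum_add, ← ENNReal.tsum_mul_left]
  refine ENNReal.tsum_le_tsum fun t => ?_
  refine le_trans ?_ (ENNReal.rpow_add_le_mul_rpow_add_rpow _ _ hp)
  rw [← add_mul]
  gcongr
  exact_mod_cast nnnorm_add_le (f t) (g t)

theorem tsum_sum_le_tsum_of_disjoint {α : Type*} (A : ℕ → Finset α)
    (hA : ∀ j k, j ≠ k → Disjoint (A j) (A k)) (f : α → ℝ≥0∞) :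
    ∑' k, ∑ t ∈ A k, f t ≤ ∑' t, f t := by
  simp_rw [← Finset.tsum_subtype]
  rw [← ENNReal.tsum_sigma (fun k (t : A k) => f t)]
  refine ENNReal.tsum_comp_le_tsum_of_injective (f := fun q : Σ k, A k => (q.2 : α)) ?_ f
  rintro ⟨j, t, ht⟩ ⟨k, u, hu⟩ h
  obtain rfl : t = u := h
  obtain rfl : j = k := by
    by_contra hjk
    exact Finset.disjoint_left.mp (hA j k hjk) ht hu
  rfl

theorem wPow_tsum_le {p : ℝ} (hp : 0 < p) (ω : G → ℝ) (h : ℕ → G → ℂ)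
    (hh : ∀ t j k, h j t ≠ 0 → h k t ≠ 0 → j = k) :
    wPow p ω (fun t => ∑' j, h j t) ≤ ∑' j, wPow p ω (h j) := by
  simp only [wPow]
  rw [ENNReal.tsum_comm]
  refine ENNReal.tsum_le_tsum fun t => ?_
  by_cases ht : ∃ j, h j t ≠ 0
  · obtain ⟨j, hj⟩ := ht
    rw [tsum_eq_single j fun k hk => by_contra fun hne => hk (hh t k j hne hj)]
    exact ENNReal.le_tsum (f := fun j => ((‖h j t‖₊ : ℝ≥0∞) * ENNReal.ofReal (ω t)) ^ p) j
  · push Not at ht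
    simp [ht, hp]

theorem exists_dense_seq_zero : ∃ v : ℕ → ℂ, v 0 = 0 ∧ DenseRange v := by
  refine ⟨fun n => Nat.casesOn n 0 (TopologicalSpace.denseSeq ℂ), rfl, ?_⟩
  refine (TopologicalSpace.denseRange_denseSeq ℂ).mono ?_
  rintro _ ⟨n, rfl⟩
  exact ⟨n + 1, rfl⟩

theorem exists_finsupp_wPow_sub_le [Countable G] {p : ℝ} (hp : 0 < p) (ω : G → ℝ)
    {v : ℕ → ℂ} (hv0 : v 0 = 0) (hv : DenseRange v) {g : G → ℂ} (hg : wPow p ω g < ⊤)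
    {η : ℝ≥0∞} (hη : η ≠ 0) :
    ∃ d : G →₀ ℕ, wPow p ω (fun t => v (d t) - g t) ≤ η := by
  classical
  have hη2 : η / 2 ≠ 0 := by simpa using hη
  obtain ⟨A, hA⟩ := ((ENNReal.tendsto_tsum_compl_atTop_zero hg.ne).eventually_le_const
    (pos_iff_ne_zero.mpr hη2)).exists
  obtain ⟨δ, hδ, hδsum⟩ := ENNReal.exists_pos_sum_of_countable' hη2 G
  have happrox : ∀ t, ∃ n, ((‖v n - g t‖₊ : ℝ≥0∞) * ENNReal.ofReal (ω t)) ^ p < δ t := by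
    intro t
    have hc : Continuous fun z : ℂ => ((‖z - g t‖₊ : ℝ≥0∞) * ENNReal.ofReal (ω t)) ^ p :=
      ENNReal.continuous_rpow_const.comp
        ((ENNReal.continuous_mul_const ENNReal.ofReal_ne_top).comp (by fun_prop))
    refine hv.exists_mem_open (isOpen_Iio.preimage hc) ⟨g t, ?_⟩
    simpa [hp] using hδ t
  choose n hn using happrox
  refine ⟨Finsupp.onFinset A (fun t => if t ∈ A then n t else 0) (by simp +contextual), ?_⟩
  set a : G → ℝ≥0∞ := fun t => (‖g t‖₊ * ENNReal.ofReal (ω t)) ^ p with ha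
  have hle : ∀ t, ((‖v (Finsupp.onFinset A (fun t => if t ∈ A then n t else 0)
        (by simp +contextual) t) - g t‖₊ : ℝ≥0∞) * ENNReal.ofReal (ω t)) ^ p
      ≤ δ t + Set.indicator {t | t ∉ A} a t := by
    intro t
    by_cases ht : t ∈ A
    · simpa [ht] using (hn t).le
    · simp [ht, hv0, ha]
  calc wPow p ω _ ≤ ∑' t, (δ t + Set.indicator {t | t ∉ A} a t) := ENNReal.tsum_le_tsum hle
    _ = ∑' t, δ t + ∑' t : {t | t ∉ A}, a t := by rw [ENNReal.tsum_add, tsum_subtype]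
    _ ≤ η / 2 + η / 2 := add_le_add hδsum.le hA
    _ = η := ENNReal.add_halves η

theorem exists_pos_le_forall_le (F : Finset G) {ω : G → ℝ} (hω : ∀ t, 0 < ω t)
    {δ : ℝ} (hδ : 0 < δ) : ∃ ε, 0 < ε ∧ ε ≤ δ ∧ ∀ u ∈ F, ε ≤ ω u := by
  classical
  induction F using Finset.induction_on with
  | empty => exact ⟨δ, hδ, le_rfl, by simp⟩
  | insert a F _ ih =>
    obtain ⟨ε, h0, h1, h2⟩ := ih
    refine ⟨min ε (ω a), lt_min h0 (hω a), (min_le_left _ _).trans h1, ?_⟩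
    intro u hu
    rcases Finset.mem_insert.mp hu with rfl | hu
    · exact min_le_right _ _
    · exact (min_le_left _ _).trans (h2 u hu)

theorem exists_approx_of_sDenseVecD [Group G] [DecidableEq G] {p : ℝ} (hp : 1 ≤ p) {S : Set G}
    {ω : G → ℝ} (hω : ∀ t, 0 < ω t) {x : G → ℂ} (hx : SDenseVecD p ω S x)
    (F : Finset G) (n : ℕ) :
    ∃ s ∈ S, wPow p ω (fun t => transl s x t - if t ∈ F then (n : ℂ) else 0) ≤ (1 / 2) ^ n ∧
      ∀ u ∈ F, ‖x (s⁻¹ * u) - n‖ < 1 / 4 := by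
  have hp0 : 0 < p := by linarith
  obtain ⟨ε, hε, hεn, hεF⟩ := exists_pos_le_forall_le F (ω := fun u => ω u / 4)
    (fun u => by have := hω u; positivity) (δ := (1 / 2) ^ n) (by positivity)
  have hfin : wPow p ω (fun t => if t ∈ F then (n : ℂ) else 0) < ⊤ := by
    rw [wPow, tsum_eq_sum (s := F) (by intro t ht; simp [ht, hp0])]
    refine ENNReal.sum_lt_top.mpr fun t _ => ?_
    exact ENNReal.rpow_lt_top_of_nonneg hp0.le
      (ENNReal.mul_ne_top ENNReal.coe_ne_top ENNReal.ofReal_ne_top)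
  obtain ⟨s, hs, hlt⟩ := hx.2 _ ((wNormD_lt_top_iff hp0 _ _).mpr hfin) ε hε
  rw [wNormD_lt_iff hp0] at hlt
  refine ⟨s, hs, hlt.le.trans ?_, fun u hu => ?_⟩
  · have h1 : ENNReal.ofReal ε ≤ (1 / 2) ^ n := by
      refine (ENNReal.ofReal_le_ofReal hεn).trans_eq ?_
      rw [ENNReal.ofReal_pow (by norm_num), ENNReal.ofReal_div_of_pos (by norm_num)]
      simp
    refine le_trans ?_ h1
    refine ENNReal.rpow_le_self_of_le_one (h1.trans (pow_le_one₀ (by simp) (by simp))) hp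
  · have h2 := (ENNReal.le_tsum (f := fun t => ((‖transl s x t - if t ∈ F then (n : ℂ) else 0‖₊ :
      ℝ≥0∞) * ENNReal.ofReal (ω t)) ^ p) u).trans_lt hlt
    rw [ENNReal.rpow_lt_rpow_iff hp0] at h2
    simp only [transl, hu, if_true] at h2
    rw [← enorm_eq_nnnorm, ← ofReal_norm, ← ENNReal.ofReal_mul (norm_nonneg _),
      ENNReal.ofReal_lt_ofReal_iff hε] at h2
    have h3 := hεF u hu
    have h4 := hω u
    by_contra hcon
    push Not at hcon
    nlinarith

theorem exists_separated_of_sDenseVecD [Group G] [DecidableEq G] {p : ℝ} (hp : 1 ≤ p)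
    {S : Set G} {ω : G → ℝ} (hω : ∀ t, 0 < ω t) {x : G → ℂ} (hx : SDenseVecD p ω S x)
    {F : ℕ → Finset G} (hF0 : F 0 = ∅) :
    ∃ s : ℕ → G, s 0 = 1 ∧ (∀ n, 1 ≤ n → s n ∈ S) ∧
      (∀ n m, n ≠ m →
        Disjoint ((F n).image fun u => (s n)⁻¹ * u) ((F m).image fun u => (s m)⁻¹ * u)) ∧
      ∑' q : ℕ × ℕ,
        (if q.1 ≠ q.2 then
          ∑ t ∈ (F q.2).image (fun u => s q.1 * (s q.2)⁻¹ * u), ENNReal.ofReal (ω t) ^ p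
        else 0) < ⊤ := by
  have hp0 : 0 < p := by linarith
  have hxtop : wPow p ω x < ⊤ := (wNormD_lt_top_iff hp0 _ _).mp hx.1
  have hex : ∀ n : ℕ, ∃ s : G, (n = 0 → s = 1) ∧ (1 ≤ n → s ∈ S) ∧
      wPow p ω (fun t => transl s x t - if t ∈ F n then (n : ℂ) else 0)
        ≤ (wPow p ω x + 1) * (1 / 2) ^ n ∧
      ∀ u ∈ F n, ‖x (s⁻¹ * u) - n‖ < 1 / 4 := by
    intro n
    rcases Nat.eq_zero_or_pos n with rfl | hn
    · exact ⟨1, by simp [hF0, transl]⟩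
    · obtain ⟨s, hs, h1, h2⟩ := exists_approx_of_sDenseVecD hp hω hx (F n) n
      exact ⟨s, by omega, fun _ => hs, h1.trans (le_mul_of_one_le_left' le_add_self), h2⟩
  choose s hs0 hsS hsQ hsF using hex
  have hdisj : ∀ n m, n ≠ m →
      Disjoint ((F n).image fun u => (s n)⁻¹ * u) ((F m).image fun u => (s m)⁻¹ * u) := by
    intro n m hnm
    rw [Finset.disjoint_left]
    intro w hw hw'
    obtain ⟨u, hu, rfl⟩ := Finset.mem_image.mp hw
    obtain ⟨u', hu', he⟩ := Finset.mem_image.mp hw'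
    have h1 := hsF n u hu
    have h2 := hsF m u' hu'
    rw [he] at h2
    have h3 : ‖(n : ℂ) - m‖ < 1 := by
      have := norm_sub_le (x ((s n)⁻¹ * u) - m) (x ((s n)⁻¹ * u) - n)
      rw [show ∀ z : ℂ, z - m - (z - n) = n - m by intro z; ring] at this
      linarith
    have h4 : ‖((n - m : ℤ) : ℂ)‖ < 1 := by push_cast; exact h3
    rw [Complex.norm_intCast] at h4
    have h5 : |(n : ℤ) - m| < 1 := by exact_mod_cast h4
    have h6 := Int.abs_lt_one_iff.mp h5
    omega
  refine ⟨s, hs0 0 rfl, hsS, hdisj, ?_⟩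
  rw [ENNReal.tsum_prod (f := fun n k => if n ≠ k then
    ∑ t ∈ (F k).image (fun u => s n * (s k)⁻¹ * u), ENNReal.ofReal (ω t) ^ p else 0)]
  have hrow : ∀ n, ∑' k, (if n ≠ k then
      ∑ t ∈ (F k).image (fun u => s n * (s k)⁻¹ * u), ENNReal.ofReal (ω t) ^ p else 0)
      ≤ 2 ^ p * ((wPow p ω x + 1) * (1 / 2) ^ n) := by
    intro n
    refine le_trans ?_ (mul_le_mul_right (hsQ n) _)
    rw [wPow, ← ENNReal.tsum_mul_left]
    refine le_trans ?_ (tsum_sum_le_tsum_of_disjoint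
      (fun k => if n ≠ k then (F k).image (fun u => s n * (s k)⁻¹ * u) else ∅) ?_ _)
    · refine ENNReal.tsum_le_tsum fun k => ?_
      split_ifs with hnk
      · refine Finset.sum_le_sum fun t ht => ?_
        obtain ⟨u, hu, rfl⟩ := Finset.mem_image.mp ht
        have hnot : s n * (s k)⁻¹ * u ∉ F n := fun hmem =>
          Finset.disjoint_left.mp (hdisj n k hnk) (Finset.mem_image_of_mem _ hmem)
            (Finset.mem_image.mpr ⟨u, hu, by group⟩)
        have hk : k ≠ 0 := by
          rintro rfl
          simp [hF0] at hu
        have hbig : 1 / 2 ≤ ‖x ((s k)⁻¹ * u)‖ := by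
          have h1 := hsF k u hu
          have h2 := norm_sub_norm_le (k : ℂ) (x ((s k)⁻¹ * u))
          rw [norm_sub_rev, Complex.norm_natCast] at h2
          have h3 : (1 : ℝ) ≤ k := by exact_mod_cast Nat.one_le_iff_ne_zero.mpr hk
          linarith
        rw [← ENNReal.mul_rpow_of_nonneg _ _ hp0.le]
        refine ENNReal.rpow_le_rpow ?_ hp0.le
        rw [← mul_assoc]
        refine le_mul_of_one_le_left' ?_
        have he : (s n)⁻¹ * (s n * (s k)⁻¹ * u) = (s k)⁻¹ * u := by group
        simp only [hnot, transl, he, if_false, sub_zero]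
        have h1 : (1 : NNReal) ≤ 2 * ‖x ((s k)⁻¹ * u)‖₊ := by
          rw [← NNReal.coe_le_coe]
          push_cast
          linarith
        exact_mod_cast h1
      · simp
    · intro j k hjk
      split_ifs
      · have hinj := Finset.disjoint_image (mul_right_injective (s n)) |>.mpr (hdisj j k hjk)
        simpa only [Finset.image_image, Function.comp_def, mul_assoc] using hinj
      all_goals simp
  refine (ENNReal.tsum_le_tsum hrow).trans_lt ?_
  rw [ENNReal.tsum_mul_left, ENNReal.tsum_mul_left]
  refine ENNReal.mul_lt_top (ENNReal.rpow_lt_top_of_nonneg hp0.le (by simp))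
    (ENNReal.mul_lt_top (ENNReal.add_lt_top.mpr ⟨hxtop, by simp⟩) ?_)
  rw [ENNReal.tsum_geometric]
  simp

theorem exists_threshold_of_tsum_lt_top {a : ℕ × ℕ → ℝ≥0∞} (ha : ∑' q, a q < ⊤) {δ : ℝ≥0∞}
    (hδ : 0 < δ) : ∃ N, ∀ n k, N ≤ n ∨ N ≤ k → a (n, k) ≤ δ := by
  have h := (ENNReal.tendsto_cofinite_zero_of_tsum_ne_top ha.ne).eventually_le_const hδ
  obtain ⟨B, hB⟩ := (Filter.eventually_cofinite.mp h).bddAbove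
  refine ⟨max B.1 B.2 + 1, fun n k hnk => ?_⟩
  by_contra hcon
  have := hB (show (n, k) ∈ {q | ¬ a q ≤ δ} from hcon)
  have h1 : n ≤ B.1 := this.1
  have h2 : k ≤ B.2 := this.2
  omega

theorem exists_strictMono_mul_le {a : ℕ × ℕ → ℝ≥0∞} (ha : ∑' q, a q < ⊤) {b : ℕ → ℝ≥0∞}
    (hb : ∀ j, b j ≠ ⊤) : ∃ φ : ℕ → ℕ, StrictMono φ ∧ (∀ j, j < φ j) ∧
      ∀ m n k, φ m ≤ n ∨ φ m ≤ k → ∀ j ≤ m, b j * a (n, k) ≤ (1 / 4) ^ m := by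
  set B : ℕ → ℝ≥0∞ := fun m => 1 + ∑ j ∈ Finset.range (m + 1), b j with hBdef
  have hB0 : ∀ m, B m ≠ 0 := fun m => by simp [hBdef]
  have hBt : ∀ m, B m ≠ ⊤ := fun m => by simp [hBdef, ENNReal.sum_eq_top, hb]
  have hex : ∀ m, ∃ N, ∀ n k, N ≤ n ∨ N ≤ k → a (n, k) ≤ (1 / 4) ^ m / B m := fun m =>
    exists_threshold_of_tsum_lt_top ha (ENNReal.div_pos (by simp) (hBt m))
  choose N hN using hex
  refine ⟨fun m => m + 1 + ∑ i ∈ Finset.range (m + 1), N i, strictMono_nat_of_lt_succ fun m => ?_,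
    fun j => by simp only; omega, fun m n k hnk j hj => ?_⟩
  · simp only [Finset.sum_range_succ _ (m + 1)]
    omega
  · have hNm : N m ≤ ∑ i ∈ Finset.range (m + 1), N i :=
      Finset.single_le_sum (fun _ _ => Nat.zero_le _) (by simp)
    have hbB : b j ≤ B m :=
      (Finset.single_le_sum (f := b) (fun _ _ => zero_le) (by simp; omega)).trans le_add_self
    calc b j * a (n, k) ≤ B m * ((1 / 4) ^ m / B m) :=
          mul_le_mul' hbB (hN m n k (by simp only at hnk; omega))
      _ = (1 / 4) ^ m := ENNReal.mul_div_cancel (hB0 m) (hBt m)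

theorem wPow_le_mul_sum [DecidableEq G] {p : ℝ} (hp : 0 < p) (ω : G → ℝ) {f : G → ℂ}
    {A : Finset G} (hA : ∀ t, f t ≠ 0 → t ∈ A) {b : ℝ≥0∞}
    (hb : ∀ t, (‖f t‖₊ : ℝ≥0∞) ^ p ≤ b) :
    wPow p ω f ≤ b * ∑ t ∈ A, ENNReal.ofReal (ω t) ^ p := by
  rw [wPow, tsum_eq_sum (s := A), Finset.mul_sum]
  · refine Finset.sum_le_sum fun t _ => ?_
    rw [ENNReal.mul_rpow_of_nonneg _ _ hp.le]
    exact mul_le_mul_left (hb t) _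
  · intro t ht
    simp [not_imp_comm.mp (hA t) ht, hp]

theorem exists_sDenseVecD_of_separated [Group G] [Countable G] [DecidableEq G] {p : ℝ}
    (hp : 1 ≤ p) {S : Set G} {ω : G → ℝ}
    (H : ∀ F : ℕ → Finset G, Monotone F → F 0 = ∅ →
      ∃ s : ℕ → G, s 0 = 1 ∧ (∀ n, 1 ≤ n → s n ∈ S) ∧
        (∀ n m, n ≠ m →
          Disjoint ((F n).image fun u => (s n)⁻¹ * u) ((F m).image fun u => (s m)⁻¹ * u)) ∧
        ∑' q : ℕ × ℕ,
          (if q.1 ≠ q.2 then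
            ∑ t ∈ (F q.2).image (fun u => s q.1 * (s q.2)⁻¹ * u), ENNReal.ofReal (ω t) ^ p
          else 0) < ⊤) :
    ∃ x : G → ℂ, SDenseVecD p ω S x := by
  have hp0 : 0 < p := by linarith
  obtain ⟨v, hv0, hv⟩ := exists_dense_seq_zero
  obtain ⟨e, he⟩ := exists_surjective_nat (G →₀ ℕ)
  set d : ℕ → G →₀ ℕ := fun j => e (Nat.unpair j).1 with hd
  set g : ℕ → G → ℂ := fun j t => v (d j t) with hg
  have hgsupp : ∀ j t, g j t ≠ 0 → t ∈ (d j).support := by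
    intro j t h
    rw [Finsupp.mem_support_iff]
    intro h0
    exact h (by simp [hg, h0, hv0])
  set F : ℕ → Finset G := fun n => (Finset.range n).biUnion fun j => (d j).support with hF
  obtain ⟨s, hs0, hsS, hdisj, hsum⟩ := H F
    (fun m n hmn => Finset.biUnion_subset_biUnion_of_subset_left _
      (Finset.range_subset_range.mpr hmn)) (by simp [hF])
  set b : ℕ → ℝ≥0∞ := fun j => ∑ t ∈ (d j).support, (‖g j t‖₊ : ℝ≥0∞) ^ p with hb
  have hbt : ∀ j, b j ≠ ⊤ := fun j => (ENNReal.sum_lt_top.mpr fun t _ =>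
    ENNReal.rpow_lt_top_of_nonneg hp0.le ENNReal.coe_ne_top).ne
  have hgb : ∀ j t, (‖g j t‖₊ : ℝ≥0∞) ^ p ≤ b j := by
    intro j t
    by_cases h : g j t = 0
    · simp [h, hp0]
    · exact Finset.single_le_sum (f := fun t => (‖g j t‖₊ : ℝ≥0∞) ^ p) (fun _ _ => zero_le)
        (hgsupp j t h)
  obtain ⟨φ, hφ, hφj, hφle⟩ := exists_strictMono_mul_le hsum hbt
  have hgF : ∀ j t, g j t ≠ 0 → t ∈ F (φ j) := fun j t h =>
    Finset.mem_biUnion.mpr ⟨j, Finset.mem_range.mpr (hφj j), hgsupp j t h⟩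
  have huniq : ∀ w j k, g j (s (φ j) * w) ≠ 0 → g k (s (φ k) * w) ≠ 0 → j = k := by
    intro w j k hj hk
    by_contra hjk
    exact Finset.disjoint_left.mp (hdisj (φ j) (φ k) (hφ.injective.ne hjk))
      (Finset.mem_image.mpr ⟨_, hgF j _ hj, inv_mul_cancel_left _ _⟩)
      (Finset.mem_image.mpr ⟨_, hgF k _ hk, inv_mul_cancel_left _ _⟩)
  have hpiece : ∀ n j, n ≠ φ j → ∀ m, φ m ≤ n ∨ φ m ≤ φ j → j ≤ m →
      wPow p ω (fun t => g j (s (φ j) * ((s n)⁻¹ * t))) ≤ (1 / 4) ^ m := by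
    intro n j hnj m hm hjm
    refine le_trans ?_ (hφle m n (φ j) hm j hjm)
    simp only [ne_eq, hnj, not_false_eq_true, if_true]
    refine wPow_le_mul_sum hp0 ω (fun t ht => ?_) fun t => hgb j _
    exact Finset.mem_image.mpr ⟨_, hgF j _ ht, by group⟩
  set x : G → ℂ := fun w => ∑' j, g j (s (φ j) * w) with hx
  have hxQ : wPow p ω x < ⊤ := by
    refine (wPow_tsum_le hp0 ω (fun j w => g j (s (φ j) * w)) huniq).trans_lt ?_
    refine lt_of_le_of_lt (b := ∑' j, (1 / 4 : ℝ≥0∞) ^ j) (ENNReal.tsum_le_tsum fun j => ?_) ?_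
    · have := hpiece 0 j (by have := hφj j; omega) j (Or.inr le_rfl) le_rfl
      simpa only [hs0, inv_one, one_mul] using this
    · rw [ENNReal.tsum_geometric, lt_top_iff_ne_top, ne_eq, ENNReal.inv_eq_top, tsub_eq_zero_iff_le,
        not_le]
      simp
  have hxapprox : ∀ i, wPow p ω (fun t => transl (s (φ i)) x t - g i t) ≤ 2 * (1 / 2) ^ i := by
    intro i
    have hsub : (fun t => transl (s (φ i)) x t - g i t) = fun t =>
        ∑' j, if j = i then 0 else g j (s (φ j) * ((s (φ i))⁻¹ * t)) := by
      funext t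
      have hsm : Summable fun j => g j (s (φ j) * ((s (φ i))⁻¹ * t)) :=
        summable_of_hasFiniteSupport
          (Set.Subsingleton.finite fun j hj k hk => huniq _ j k hj hk)
      rw [transl, hx]
      simp only
      rw [hsm.tsum_eq_add_tsum_ite i, mul_inv_cancel_left, add_sub_cancel_left]
    rw [hsub]
    refine (wPow_tsum_le hp0 ω _ fun t j k hj hk => ?_).trans ?_
    · exact huniq _ j k (ite_ne_left_iff.mp hj).2.symm (ite_ne_left_iff.mp hk).2.symm
    · have hterm : ∀ j, wPow p ω (fun t => if j = i then 0 else
          g j (s (φ j) * ((s (φ i))⁻¹ * t))) ≤ (1 / 2) ^ i * (1 / 2) ^ j := by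
        intro j
        rcases eq_or_ne j i with rfl | hji
        · simp [wPow, hp0]
        · simp only [hji, if_false]
          refine (hpiece (φ i) j (hφ.injective.ne hji.symm) (max i j) ?_ (le_max_right _ _)).trans ?_
          · rcases le_total i j with h | h <;> simp [h]
          · have h4 : (1 / 4 : ℝ≥0∞) = 1 / 2 * (1 / 2) := by
              simp only [one_div]
              rw [← ENNReal.mul_inv (by simp) (by simp)]
              norm_num
            rw [h4, mul_pow]
            exact mul_le_mul' (pow_le_pow_right_of_le_one' (by simp) (le_max_left _ _))
              (pow_le_pow_right_of_le_one' (by simp) (le_max_right _ _))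
      refine (ENNReal.tsum_le_tsum hterm).trans_eq ?_
      rw [ENNReal.tsum_mul_left, ENNReal.tsum_geometric, mul_comm]
      simp
  refine ⟨x, (wNormD_lt_top_iff hp0 _ _).mpr hxQ, fun f hf ε hε => ?_⟩
  rw [wNormD_lt_top_iff hp0] at hf
  have hC0 : (2 : ℝ≥0∞) ^ (p - 1) * 2 ≠ 0 := by
    simp [ENNReal.rpow_eq_zero_iff]
  have hCt : (2 : ℝ≥0∞) ^ (p - 1) * 2 ≠ ⊤ :=
    ENNReal.mul_ne_top (ENNReal.rpow_ne_top_of_nonneg (by linarith) (by simp)) (by simp)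
  have hε' : 0 < ENNReal.ofReal ε ^ p := ENNReal.rpow_pos (by simpa using hε) (by simp)
  obtain ⟨r, hr0, hr⟩ := exists_between hε'
  have hη : r / (2 ^ (p - 1) * 2) ≠ 0 := (ENNReal.div_pos hr0.ne' hCt).ne'
  obtain ⟨D, hD⟩ := exists_finsupp_wPow_sub_le hp0 ω hv0 hv hf hη
  have hlim : Tendsto (fun i : ℕ => 2 * (1 / 2 : ℝ≥0∞) ^ i) atTop (𝓝 0) := by
    have h := ENNReal.tendsto_pow_atTop_nhds_zero_of_lt_one (r := 1 / 2) (by simp)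
    simpa using ENNReal.Tendsto.const_mul h (Or.inr (by simp : (2 : ℝ≥0∞) ≠ ⊤))
  obtain ⟨M, hM⟩ := eventually_atTop.mp (hlim.eventually_le_const (pos_iff_ne_zero.mpr hη))
  obtain ⟨k, hk⟩ := he D
  set i := Nat.pair k M with hi
  have hgi : ∀ t, g i t = v (D t) := fun t => by simp [hg, hd, hi, hk]
  refine ⟨s (φ i), hsS _ (by have := hφj i; omega), (wNormD_lt_iff hp0 _ _ _).mpr ?_⟩
  refine lt_of_le_of_lt ?_ hr
  have hadd := wPow_add_le hp ω (fun t => transl (s (φ i)) x t - g i t) (fun t => g i t - f t)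
  simp only [sub_add_sub_cancel] at hadd
  refine hadd.trans ?_
  have h1 := (hxapprox i).trans (hM i (Nat.right_le_pair k M))
  have h2 : wPow p ω (fun t => g i t - f t) ≤ r / (2 ^ (p - 1) * 2) := by
    simpa only [hgi] using hD
  calc (2 : ℝ≥0∞) ^ (p - 1) * (_ + _)
      ≤ 2 ^ (p - 1) * (r / (2 ^ (p - 1) * 2) + r / (2 ^ (p - 1) * 2)) := by gcongr
    _ = (2 ^ (p - 1) * 2) * (r / (2 ^ (p - 1) * 2)) := by rw [← two_mul, mul_assoc]
    _ = r := ENNReal.mul_div_cancel hC0 hCt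

/-- Salas-type criterion for an infinite countable discrete group. -/
theorem stmt4 [Group G] [Countable G] [Infinite G] [DecidableEq G]
    (p : ℝ) (hp : 1 ≤ p) (S : Set G) (ω : G → ℝ) (hωpos : ∀ t, 0 < ω t)
    (hadm : ∀ s ∈ S, BoundedTranslD p ω s) :
    (∃ x : G → ℂ, SDenseVecD p ω S x) ↔
      ∀ F : ℕ → Finset G, Monotone F → F 0 = ∅ →
        ∃ s : ℕ → G, s 0 = 1 ∧ (∀ n, 1 ≤ n → s n ∈ S) ∧
          (∀ n m, n ≠ m →
            Disjoint ((F n).image fun u => (s n)⁻¹ * u)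
              ((F m).image fun u => (s m)⁻¹ * u)) ∧
          ∑' q : ℕ × ℕ,
              (if q.1 ≠ q.2 then
                ∑ t ∈ (F q.2).image (fun u => s q.1 * (s q.2)⁻¹ * u),
                  ENNReal.ofReal (ω t) ^ p
              else 0) < ⊤ := by
  exact ⟨fun ⟨_, hx⟩ _ _ hF0 => exists_separated_of_sDenseVecD hp hωpos hx hF0,
    exists_sDenseVecD_of_separated hp⟩
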